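/- Under Gibbs sampling of the embedded star Hamiltonian at inverse temperature β_eff, the probability of the event that s₁ = s₂ and the configuration (s_c, x, y) with s_c = s₁ = s₂ is a ground state (minimizer) of the star Hamiltonian H_star = (1 + s_c)·(x₁ + ⋯ + x_l) − (1 − s_c)·(y₁ + ⋯ + y_l) equals [2 / (2 + e^{−z·λ}·(cosh^l(z) + cosh^{−l}(z)))] · (1 + e^{−2·z})^{−l}. -/

import Mathlib

open scoped Classical
open Finset Real

/-- Spin value of a boolean: `true ↦ +1`, `false ↦ -1`. -/
noncomputable def spin (b : Bool) : ℝ := if b then 1 else -1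

/-- The embedded star Hamiltonian
`H_e^λ = -λ·s₁·s₂ + (s₁+1)·(x₁+⋯+x_l) + (s₂-1)·(y₁+⋯+y_l)` on configurations
`σ = (s₁, s₂, x, y)`. -/
noncomputable def He (l : ℕ) (lam : ℝ)
    (σ : Bool × Bool × (Fin l → Bool) × (Fin l → Bool)) : ℝ :=
  -lam * spin σ.1 * spin σ.2.1 + (spin σ.1 + 1) * (∑ i, spin (σ.2.2.1 i)) +
    (spin σ.2.1 - 1) * (∑ i, spin (σ.2.2.2 i))

/-- The star Hamiltonian
`H_star = (1 + s_c)·(x₁+⋯+x_l) - (1 - s_c)·(y₁+⋯+y_l)` on configurations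
`σ = (s_c, x, y)`. -/
noncomputable def Hstar (l : ℕ) (σ : Bool × (Fin l → Bool) × (Fin l → Bool)) : ℝ :=
  (1 + spin σ.1) * (∑ i, spin (σ.2.1 i)) - (1 - spin σ.1) * (∑ i, spin (σ.2.2 i))

theorem sum_spin_le {l : ℕ} (x : Fin l → Bool) : ∑ i, spin (x i) ≤ l := by
  have h : ∑ i, spin (x i) ≤ ∑ _i : Fin l, (1 : ℝ) :=
    Finset.sum_le_sum fun i _ => by cases x i <;> norm_num [spin]
  simpa using h

theorem neg_le_sum_spin {l : ℕ} (x : Fin l → Bool) : -(l : ℝ) ≤ ∑ i, spin (x i) := by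
  have h : ∑ _i : Fin l, (-1 : ℝ) ≤ ∑ i, spin (x i) :=
    Finset.sum_le_sum fun i _ => by cases x i <;> norm_num [spin]
  simpa using h

theorem sum_spin_eq_iff {l : ℕ} (x : Fin l → Bool) :
    ∑ i, spin (x i) = l ↔ x = fun _ => true := by
  have h := Finset.sum_eq_sum_iff_of_le (s := Finset.univ) (f := fun i => spin (x i))
    (g := fun _ => (1 : ℝ)) fun i _ => by cases x i <;> norm_num [spin]
  have hs (b : Bool) : spin b = 1 ↔ b = true := by cases b <;> norm_num [spin]
  simpa [hs, funext_iff] using h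

theorem sum_spin_eq_neg_iff {l : ℕ} (x : Fin l → Bool) :
    ∑ i, spin (x i) = -l ↔ x = fun _ => false := by
  have h := Finset.sum_eq_sum_iff_of_le (s := Finset.univ) (f := fun _ => (-1 : ℝ))
    (g := fun i => spin (x i)) fun i _ => by cases x i <;> norm_num [spin]
  have hs (b : Bool) : -1 = spin b ↔ b = false := by cases b <;> norm_num [spin]
  rw [eq_comm]
  simpa [hs, funext_iff] using h

theorem neg_two_mul_le_Hstar {l : ℕ} (t : Bool × (Fin l → Bool) × (Fin l → Bool)) :
    -(2 * l : ℝ) ≤ Hstar l t := by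
  obtain ⟨s, x, y⟩ := t
  have hx := neg_le_sum_spin x
  have hy := sum_spin_le y
  cases s <;> simp only [Hstar] <;> norm_num [spin] at * <;> linarith

/-- The minimum of `Hstar` is `-2l`. -/
theorem forall_Hstar_le_iff {l : ℕ} (t : Bool × (Fin l → Bool) × (Fin l → Bool)) :
    (∀ t', Hstar l t ≤ Hstar l t') ↔ Hstar l t = -(2 * l) := by
  constructor
  · intro h
    refine le_antisymm ((h (true, fun _ => false, fun _ => false)).trans_eq ?_)
      (neg_two_mul_le_Hstar t)
    norm_num [Hstar, spin]
  · intro h t'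
    exact h.trans_le (neg_two_mul_le_Hstar t')

theorem forall_Hstar_true_le_iff {l : ℕ} (x y : Fin l → Bool) :
    (∀ t, Hstar l (true, x, y) ≤ Hstar l t) ↔ x = fun _ => false := by
  rw [forall_Hstar_le_iff, ← sum_spin_eq_neg_iff]
  have : Hstar l (true, x, y) = 2 * ∑ i, spin (x i) := by
    simp only [Hstar, show spin true = 1 by simp [spin]]; ring
  rw [this]
  constructor <;> intro h <;> linarith

theorem forall_Hstar_false_le_iff {l : ℕ} (x y : Fin l → Bool) :
    (∀ t, Hstar l (false, x, y) ≤ Hstar l t) ↔ y = fun _ => true := by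
  rw [forall_Hstar_le_iff, ← sum_spin_eq_iff]
  have : Hstar l (false, x, y) = -(2 * ∑ i, spin (y i)) := by
    simp only [Hstar, show spin false = -1 by simp [spin]]; ring
  rw [this]
  constructor <;> intro h <;> linarith

theorem sum_exp_mul_sum_spin (l : ℕ) (a : ℝ) :
    ∑ x : Fin l → Bool, Real.exp (a * ∑ i, spin (x i)) = (2 * Real.cosh a) ^ l := by
  have h : 2 * Real.cosh a = ∑ b : Bool, Real.exp (a * spin b) := by
    simp [Real.cosh_eq, spin]; ring
  rw [h, Fintype.sum_pow]
  simp [Finset.mul_sum, Real.exp_sum]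

/-- The Boltzmann weight of the embedded Hamiltonian factorizes over the two arms of the star. -/
theorem exp_neg_mul_He (l : ℕ) (lam β : ℝ) (s₁ s₂ : Bool) (x y : Fin l → Bool) :
    Real.exp (-β * He l lam (s₁, s₂, x, y)) =
      Real.exp (β * lam * spin s₁ * spin s₂) *
        (Real.exp (-β * (spin s₁ + 1) * ∑ i, spin (x i)) *
          Real.exp (-β * (spin s₂ - 1) * ∑ i, spin (y i))) := by
  rw [← Real.exp_add, ← Real.exp_add]
  congr 1
  simp only [He]
  ring

theorem sum_exp_neg_mul_He (l : ℕ) (lam β : ℝ) :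
    ∑ σ, Real.exp (-β * He l lam σ) =
      2 * (Real.exp (β * lam) * (2 * Real.cosh (2 * β)) ^ l * 2 ^ l) +
        Real.exp (-(β * lam)) * ((2 * Real.cosh (2 * β)) ^ l * (2 * Real.cosh (2 * β)) ^ l
          + 2 ^ l * 2 ^ l) := by
  simp only [Fintype.sum_prod_type, exp_neg_mul_He, ← Finset.mul_sum, ← Finset.sum_mul,
    sum_exp_mul_sum_spin, Fintype.sum_bool]
  have h₁ : -β * (1 + 1) = -(2 * β) := by ring
  have h₂ : -β * (-1 - 1) = 2 * β := by ring
  simp only [spin, if_true, Bool.false_eq_true, if_false, h₁, h₂, Real.cosh_neg]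
  norm_num
  ring

theorem sum_ground_exp_neg_mul_He (l : ℕ) (lam β : ℝ) :
    ∑ σ ∈ Finset.univ.filter
        (fun σ : Bool × Bool × (Fin l → Bool) × (Fin l → Bool) =>
          σ.1 = σ.2.1 ∧ ∀ t, Hstar l (σ.1, σ.2.2.1, σ.2.2.2) ≤ Hstar l t),
      Real.exp (-β * He l lam σ) =
    2 * (Real.exp (β * lam) * Real.exp (2 * β) ^ l * 2 ^ l) := by
  rw [Finset.sum_filter]
  simp only [Fintype.sum_prod_type, Fintype.sum_bool, forall_Hstar_true_le_iff,
    forall_Hstar_false_le_iff, true_and, Bool.true_eq_false, Bool.false_eq_true, false_and,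
    if_false, Finset.sum_const_zero, add_zero, zero_add]
  rw [Finset.sum_comm]
  simp only [Finset.sum_ite_eq', Finset.mem_univ, if_true, exp_neg_mul_He, ← Finset.mul_sum,
    sum_exp_mul_sum_spin, ← Finset.sum_mul]
  norm_num [spin, ← Real.exp_nat_mul]
  ring_nf

/-- **Sparse-solver solution probability for the star problem.**
Under Gibbs sampling of the embedded star Hamiltonian at inverse temperature
`βeff` (with `z = 2βeff`), the probability that `s₁ = s₂` and that the logical
configuration `(s_c, x, y)` with `s_c = s₁ = s₂` is a ground state of `H_star`
equals `[2/(2 + e^{-zλ}·(cosh^l z + cosh^{-l} z))]·(1 + e^{-2z})^{-l}`. -/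
theorem star_sparse_solution_probability (l : ℕ) (hl : 1 ≤ l) (lam βeff : ℝ)
    (hlam : 0 < lam) (hβ : 0 < βeff) (z : ℝ) (hz : z = 2 * βeff) :
    (∑ σ ∈ Finset.univ.filter
          (fun σ : Bool × Bool × (Fin l → Bool) × (Fin l → Bool) =>
            σ.1 = σ.2.1 ∧ ∀ t, Hstar l (σ.1, σ.2.2.1, σ.2.2.2) ≤ Hstar l t),
        Real.exp (-βeff * He l lam σ)) /
      (∑ σ : Bool × Bool × (Fin l → Bool) × (Fin l → Bool),
        Real.exp (-βeff * He l lam σ)) =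
    2 / (2 + Real.exp (-(z * lam)) * (Real.cosh z ^ l + (Real.cosh z ^ l)⁻¹)) *
      ((1 + Real.exp (-(2 * z))) ^ l)⁻¹ := by
  subst hz
  rw [sum_ground_exp_neg_mul_He, sum_exp_neg_mul_He]
  set c := Real.cosh (2 * βeff) with hc
  have hc0 : 0 < c := Real.cosh_pos _
  have hchain : Real.exp (-(βeff * lam)) =
      Real.exp (βeff * lam) * Real.exp (-(2 * βeff * lam)) := by
    rw [← Real.exp_add]; ring_nf
  have hlogical : Real.exp (2 * βeff) * (1 + Real.exp (-(2 * (2 * βeff)))) = 2 * c := by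
    rw [mul_add, ← Real.exp_add, hc, Real.cosh_eq]; ring_nf
  have hlogical_pow : Real.exp (2 * βeff) ^ l * (1 + Real.exp (-(2 * (2 * βeff)))) ^ l =
      2 ^ l * c ^ l := by
    rw [← mul_pow, hlogical, mul_pow]
  have hq : 0 < (1 + Real.exp (-(2 * (2 * βeff)))) ^ l := by positivity
  rw [hchain, eq_div_of_mul_eq hq.ne' hlogical_pow, mul_pow]
  field_simp
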